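/- arXiv:1701.03778 — 8 statements merged into one kernel-verified Lean document; each statement's English description precedes it below -/
import Mathlib

section
/- Let T = (T, m, e) be a Kock-Zöberlein monad on an order-enriched category C and let A be an object of C. Define M_T to be the class of morphisms h : X → Y of C such that T(h) has a right adjoint g : TY → TX with g ∘ T(h) = id_{TX}. The following are equivalent: (i) A is injective with respect to all unit morphisms e_X : X → TX, i.e., for every object X and every f : X → A there exists f' : TX → A with f' ∘ e_X = f; (ii) A carries an Eilenberg–Moore T-algebra structure, i.e., there exists α : TA → A with α ∘ e_A = id_A and α ∘ T(α) = α ∘ m_A; (iii) A is injective with respect to every morphism in M_T, i.e., for every h : X → Y in M_T and every f : X → A there exists f' : Y → A with f' ∘ h = f. -/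
open CategoryTheory

universe v u

/-- An order-enrichment of a category: a partial order on every hom-set such that
composition is monotone in both variables. -/
structure OrderEnrichment (C : Type u) [Category.{v} C] where
  le : ∀ {X Y : C}, (X ⟶ Y) → (X ⟶ Y) → Prop
  le_refl : ∀ {X Y : C} (f : X ⟶ Y), le f f
  le_trans : ∀ {X Y : C} {f g h : X ⟶ Y}, le f g → le g h → le f h
  le_antisymm : ∀ {X Y : C} {f g : X ⟶ Y}, le f g → le g f → f = g
  comp_le_comp_right : ∀ {X Y Z : C} {f g : X ⟶ Y} (h : Y ⟶ Z), le f g → le (f ≫ h) (g ≫ h)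
  comp_le_comp_left : ∀ {X Y Z : C} (h : X ⟶ Y) {f g : Y ⟶ Z}, le f g → le (h ≫ f) (h ≫ g)

/-- For a lax idempotent monad, a retraction `α` of the unit satisfies `𝟙 ≤ e ∘ α`. -/
theorem OrderEnrichment.id_le_comp_unit {C : Type u} [Category.{v} C] (E : OrderEnrichment C)
    (T : Monad C) (hKZ : ∀ X : C, E.le (T.map (T.η.app X)) (T.η.app (T.obj X)))
    {A : C} {α : T.obj A ⟶ A} (hα : T.η.app A ≫ α = 𝟙 A) :
    E.le (𝟙 (T.obj A)) (α ≫ T.η.app A) := by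
  have h := E.comp_le_comp_right (T.map α) (hKZ A)
  have hm : T.map (T.η.app A) ≫ T.map α = 𝟙 (T.obj A) := by
    rw [← T.map_comp, hα]
    exact T.map_id A
  rwa [hm, ← T.unit_naturality _ α] at h

/-- For a lax idempotent monad, every retraction of the unit is an algebra structure. -/
theorem OrderEnrichment.assoc_of_unit_comp_eq_id {C : Type u} [Category.{v} C]
    (E : OrderEnrichment C) (T : Monad C)
    (hT : ∀ {X Y : C} {f g : X ⟶ Y}, E.le f g → E.le (T.map f) (T.map g))
    (hKZ : ∀ X : C, E.le (T.map (T.η.app X)) (T.η.app (T.obj X)))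
    {A : C} {α : T.obj A ⟶ A} (hα : T.η.app A ≫ α = 𝟙 A) :
    T.map α ≫ α = T.μ.app A ≫ α := by
  apply E.le_antisymm
  · have h := E.comp_le_comp_right (T.map α ≫ α)
      (E.id_le_comp_unit T hKZ (T.left_unit A))
    have hn : T.η.app (T.obj A) ≫ T.map α ≫ α = α := by
      rw [← Category.assoc, ← T.unit_naturality _ α, Category.assoc, hα, Category.comp_id]
    rwa [Category.id_comp, Category.assoc, hn] at h
  · have h := E.comp_le_comp_right (T.μ.app A ≫ α) (hT (E.id_le_comp_unit T hKZ hα))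
    have hu : T.map (T.η.app A) ≫ T.μ.app A ≫ α = α := by
      rw [← Category.assoc, T.right_unit, Category.id_comp]
    rwa [T.map_id, Category.id_comp, T.map_comp, Category.assoc, hu] at h

/-- For a lax idempotent monad, the multiplication is right adjoint to `T e`. -/
theorem OrderEnrichment.mul_comp_map_unit_le_id {C : Type u} [Category.{v} C]
    (E : OrderEnrichment C) (T : Monad C)
    (hT : ∀ {X Y : C} {f g : X ⟶ Y}, E.le f g → E.le (T.map f) (T.map g))
    (hKZ : ∀ X : C, E.le (T.map (T.η.app X)) (T.η.app (T.obj X))) (X : C) :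
    E.le (T.μ.app X ≫ T.map (T.η.app X)) (𝟙 (T.obj (T.obj X))) := by
  have h := E.comp_le_comp_right (T.μ.app (T.obj X)) (hT (hKZ X))
  rwa [T.right_unit, T.mu_naturality _] at h


/-- For a Kock-Zöberlein monad `T` on an order-enriched category and an object
`A`, TFAE: (i) `A` is injective w.r.t. all units `e_X`; (ii) `A` carries an Eilenberg–Moore
`T`-algebra structure; (iii) `A` is injective w.r.t. every morphism `h` in `M_T`, i.e. such
that `T h` has a right adjoint `g` with `g ∘ T h = id`. -/
theorem stmt2 {C : Type u} [Category.{v} C] (E : OrderEnrichment C) (T : Monad C)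
    (hT : ∀ {X Y : C} {f g : X ⟶ Y}, E.le f g → E.le (T.map f) (T.map g))
    (hKZ : ∀ X : C, E.le (T.map (T.η.app X)) (T.η.app (T.obj X)))
    (A : C) :
    List.TFAE
      [ ∀ (X : C) (f : X ⟶ A), ∃ f' : T.obj X ⟶ A, T.η.app X ≫ f' = f
      , ∃ α : T.obj A ⟶ A, T.η.app A ≫ α = 𝟙 A ∧ T.map α ≫ α = T.μ.app A ≫ α
      , ∀ (X Y : C) (h : X ⟶ Y),
          (∃ g : T.obj Y ⟶ T.obj X,
            T.map h ≫ g = 𝟙 (T.obj X) ∧ E.le (g ≫ T.map h) (𝟙 (T.obj Y))) →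
          ∀ f : X ⟶ A, ∃ f' : Y ⟶ A, h ≫ f' = f ] := by
  tfae_have 1 → 2 := by
    intro h
    obtain ⟨α, hα⟩ := h A (𝟙 A)
    exact ⟨α, hα, E.assoc_of_unit_comp_eq_id T hT hKZ hα⟩
  tfae_have 2 → 3 := by
    rintro ⟨α, hα, -⟩ X Y h ⟨g, hg, -⟩ f
    refine ⟨T.η.app Y ≫ g ≫ T.map f ≫ α, ?_⟩
    rw [← Category.assoc, T.unit_naturality _ h, Category.assoc, ← Category.assoc (T.map h), hg,
      Category.id_comp, ← Category.assoc, ← T.unit_naturality _ f, Category.assoc, hα,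
      Category.comp_id]
  tfae_have 3 → 1 := fun h X f =>
    h X (T.obj X) (T.η.app X)
      ⟨T.μ.app X, T.right_unit X, E.mul_comp_map_unit_le_id T hT hKZ X⟩ f
  tfae_finish
end

section
/- Let T = (T, m, e) be an order-enriched monad on an order-enriched category C. The following are equivalent: (i) for every object X, e_X is an order-mono (for all f, g : A → X, e_X ∘ f ≤ e_X ∘ g implies f ≤ g); (ii) T is order-faithful (for all f, g : A → X, T(f) ≤ T(g) implies f ≤ g). Moreover, if T is of Kock-Zöberlein type, these are also equivalent to: (iii) every morphism in M_T is an order-mono, where M_T is the class of morphisms h : X → Y such that T(h) has a right adjoint g : TY → TX with g ∘ T(h) = id_{TX}. -/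
open CategoryTheory

universe v u

/-- For an order-enriched monad `T`: (i) every unit `e_X` is order-mono iff
(ii) `T` is order-faithful; and if moreover `T` is of Kock-Zöberlein type, these are also
equivalent to (iii): every morphism of `M_T` is order-mono. -/
theorem stmt3 {C : Type u} [Category.{v} C] (E : OrderEnrichment C) (T : Monad C)
    (hT : ∀ {X Y : C} {f g : X ⟶ Y}, E.le f g → E.le (T.map f) (T.map g)) :
    ((∀ (X A : C) (f g : A ⟶ X), E.le (f ≫ T.η.app X) (g ≫ T.η.app X) → E.le f g) ↔
      (∀ (X A : C) (f g : A ⟶ X), E.le (T.map f) (T.map g) → E.le f g)) ∧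
    ((∀ X : C, E.le (T.map (T.η.app X)) (T.η.app (T.obj X))) →
      ((∀ (X A : C) (f g : A ⟶ X), E.le (f ≫ T.η.app X) (g ≫ T.η.app X) → E.le f g) ↔
        (∀ (X Y : C) (h : X ⟶ Y),
          (∃ g : T.obj Y ⟶ T.obj X,
            T.map h ≫ g = 𝟙 (T.obj X) ∧ E.le (g ≫ T.map h) (𝟙 (T.obj Y))) →
          ∀ (A : C) (f g : A ⟶ X), E.le (f ≫ h) (g ≫ h) → E.le f g))) := by
  have faithful_of_unit
      (hη : ∀ (X A : C) (f g : A ⟶ X), E.le (f ≫ T.η.app X) (g ≫ T.η.app X) → E.le f g)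
      (X A : C) (f g : A ⟶ X) (h : E.le (T.map f) (T.map g)) : E.le f g := by
    apply hη
    have hf := T.η.naturality f
    have hg := T.η.naturality g
    simp only [Functor.id_map] at hf hg
    rw [hf, hg]
    exact E.comp_le_comp_left _ h
  refine ⟨⟨faithful_of_unit, fun hF X A f g h => ?_⟩,
    fun hKZ => ⟨fun hη X Y h ⟨r, hr, _⟩ A f g hfg => ?_, fun hM X A f g => ?_⟩⟩
  · apply hF
    simpa using E.comp_le_comp_right (T.μ.app X) (hT h)
  · apply faithful_of_unit hη
    simpa [hr] using E.comp_le_comp_right r (hT hfg)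
  · refine hM _ _ _ ⟨T.μ.app X, T.right_unit X, ?_⟩ A f g
    have nat : T.map (T.map (T.η.app X)) ≫ T.μ.app (T.obj X) = T.μ.app X ≫ T.map (T.η.app X) :=
      T.μ.naturality (T.η.app X)
    have unit : T.map (T.η.app (T.obj X)) ≫ T.μ.app (T.obj X) = 𝟙 (T.obj (T.obj X)) :=
      T.right_unit (T.obj X)
    have key := E.comp_le_comp_right (T.μ.app (T.obj X)) (hT (hKZ X))
    rwa [nat, unit] at key
end

section
/- Let T = (T, m, e) be a Kock-Zöberlein monad on an order-enriched category C. (a) If Y carries an Eilenberg–Moore T-algebra structure β : TY → Y, then Y is Cauchy complete: for every object X and all morphisms r : X → TY and s : Y → TX satisfying e_X ≤ m_X ∘ T(s) ∘ r and m_Y ∘ T(r) ∘ s ≤ e_Y (i.e., r is left adjoint to s in the Kleisli category), there exists f : X → Y with r = e_Y ∘ f. (b) If moreover T is order-faithful (T(f) ≤ T(g) implies f ≤ g), then an object Y carries an Eilenberg–Moore T-algebra structure if and only if Y is Cauchy complete and T(e_Y) : TY → TTY has a left adjoint in C (there exists l : TTY → TY with l ⊣ T(e_Y)). -/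
open CategoryTheory

universe v u

/-- `Y` is Cauchy complete for a monad `T`: every left adjoint morphism `r : X ⇸ Y` in the
Kleisli category (with right adjoint `s : Y ⇸ X`) is of the form `e_Y ∘ f` for some
`f : X ⟶ Y` in `C`. -/
def CauchyComplete {C : Type u} [Category.{v} C] (E : OrderEnrichment C) (T : Monad C)
    (Y : C) : Prop :=
  ∀ (X : C) (r : X ⟶ T.obj Y) (s : Y ⟶ T.obj X),
    E.le (T.η.app X) (r ≫ T.map s ≫ T.μ.app X) →
    E.le (s ≫ T.map r ≫ T.μ.app Y) (T.η.app Y) →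
    ∃ f : X ⟶ Y, r = f ≫ T.η.app Y

namespace OrderEnrichment

variable {C : Type u} [Category.{v} C] (E : OrderEnrichment C)

/-- `f ⊣ g` in an order-enriched category. -/
def Adj {X Y : C} (f : X ⟶ Y) (g : Y ⟶ X) : Prop :=
  E.le (𝟙 X) (f ≫ g) ∧ E.le (g ≫ f) (𝟙 Y)

variable {E}

theorem Adj.comp {X Y Z : C} {f : X ⟶ Y} {g : Y ⟶ X} {f' : Y ⟶ Z} {g' : Z ⟶ Y}
    (h : E.Adj f g) (h' : E.Adj f' g') : E.Adj (f ≫ f') (g' ≫ g) := by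
  constructor
  · refine E.le_trans h.1 ?_
    simpa using E.comp_le_comp_left f (E.comp_le_comp_right g h'.1)
  · refine E.le_trans ?_ h'.2
    simpa using E.comp_le_comp_left g' (E.comp_le_comp_right f' h.2)

theorem Adj.left_le {X Y : C} {f f' : X ⟶ Y} {g : Y ⟶ X}
    (h : E.Adj f g) (h' : E.Adj f' g) : E.le f f' := by
  have h₁ := E.comp_le_comp_right f h'.1
  have h₂ := E.comp_le_comp_left f' h.2
  simp only [Category.id_comp, Category.comp_id, Category.assoc] at h₁ h₂
  exact E.le_trans h₁ h₂

theorem Adj.left_unique {X Y : C} {f f' : X ⟶ Y} {g : Y ⟶ X}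
    (h : E.Adj f g) (h' : E.Adj f' g) : f = f' :=
  E.le_antisymm (h.left_le h') (h'.left_le h)

section Monad

variable {T : Monad C}

theorem Adj.map (hT : ∀ {X Y : C} {f g : X ⟶ Y}, E.le f g → E.le (T.map f) (T.map g))
    {X Y : C} {f : X ⟶ Y} {g : Y ⟶ X} (h : E.Adj f g) : E.Adj (T.map f) (T.map g) :=
  ⟨by simpa using hT h.1, by simpa using hT h.2⟩

/-- The structure morphism of an algebra for a Kock-Zöberlein monad is left adjoint to the unit;
associativity is not needed. -/
theorem adj_unit_of_retraction
    (hKZ : ∀ X : C, E.le (T.map (T.η.app X)) (T.η.app (T.obj X)))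
    {Y : C} {β : T.obj Y ⟶ Y} (hβ : T.η.app Y ≫ β = 𝟙 Y) : E.Adj β (T.η.app Y) := by
  constructor
  · have h := E.comp_le_comp_right (T.map β) (hKZ Y)
    have hid : T.map (T.η.app Y) ≫ T.map β = 𝟙 (T.obj Y) := by
      rw [← T.map_comp, hβ]
      exact T.map_id Y
    rw [hid] at h
    have n : β ≫ T.η.app Y = T.η.app (T.obj Y) ≫ T.map β := T.η.naturality β
    rwa [n]
  · rw [hβ]
    exact E.le_refl _

theorem le_of_comp_unit_le
    (hT : ∀ {X Y : C} {f g : X ⟶ Y}, E.le f g → E.le (T.map f) (T.map g))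
    (hF : ∀ (X A : C) (f g : A ⟶ X), E.le (T.map f) (T.map g) → E.le f g)
    {X Y : C} {f g : X ⟶ Y} (h : E.le (f ≫ T.η.app Y) (g ≫ T.η.app Y)) : E.le f g := by
  apply hF
  simpa using E.comp_le_comp_right (T.μ.app Y) (hT h)

theorem cauchyComplete_of_algebra
    (hT : ∀ {X Y : C} {f g : X ⟶ Y}, E.le f g → E.le (T.map f) (T.map g))
    (hKZ : ∀ X : C, E.le (T.map (T.η.app X)) (T.η.app (T.obj X)))
    {Y : C} {β : T.obj Y ⟶ Y} (hη : T.η.app Y ≫ β = 𝟙 Y)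
    (hμ : T.map β ≫ β = T.μ.app Y ≫ β) : CauchyComplete E T Y := by
  intro X r s h₁ h₂
  have hβ := OrderEnrichment.adj_unit_of_retraction hKZ hη
  refine ⟨r ≫ β, E.le_antisymm ?_ ?_⟩
  · simpa using E.comp_le_comp_left r hβ.1
  have counit : E.le (s ≫ T.map (r ≫ β)) (T.η.app Y) := by
    have h₃ := E.comp_le_comp_left (s ≫ T.map (r ≫ β)) hβ.1
    have h₄ := E.comp_le_comp_right (β ≫ T.η.app Y) h₂
    simp only [Category.comp_id, Category.assoc, T.map_comp, reassoc_of% hμ,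
      reassoc_of% hη] at h₃ h₄ ⊢
    exact E.le_trans h₃ h₄
  have h₅ := E.comp_le_comp_right (T.map (r ≫ β)) h₁
  have h₆ := E.comp_le_comp_left r (E.comp_le_comp_right (T.μ.app Y) (hT counit))
  have nη : T.η.app X ≫ T.map (r ≫ β) = (r ≫ β) ≫ T.η.app Y := (T.η.naturality (r ≫ β)).symm
  have nμ : T.μ.app X ≫ T.map (r ≫ β) = T.map (T.map (r ≫ β)) ≫ T.μ.app Y :=
    (T.μ.naturality (r ≫ β)).symm
  rw [nη, Category.assoc r (T.map s ≫ T.μ.app X), Category.assoc (T.map s), nμ] at h₅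
  have hid : r ≫ T.map (T.η.app Y) ≫ T.μ.app Y = r := by simp
  rw [T.map_comp, Category.assoc, hid] at h₆
  exact E.le_trans h₅ h₆

theorem exists_algebra_of_cauchyComplete
    (hT : ∀ {X Y : C} {f g : X ⟶ Y}, E.le f g → E.le (T.map f) (T.map g))
    (hKZ : ∀ X : C, E.le (T.map (T.η.app X)) (T.η.app (T.obj X)))
    (hF : ∀ (X A : C) (f g : A ⟶ X), E.le (T.map f) (T.map g) → E.le f g)
    {Y : C} (hY : CauchyComplete E T Y) {l : T.obj (T.obj Y) ⟶ T.obj Y}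
    (hl : E.Adj l (T.map (T.η.app Y))) :
    ∃ β : T.obj Y ⟶ Y, T.η.app Y ≫ β = 𝟙 Y ∧ T.map β ≫ β = T.μ.app Y ≫ β := by
  have nη {A B : C} (f : A ⟶ B) : T.η.app A ≫ T.map f = f ≫ T.η.app B := (T.η.naturality f).symm
  have μ_adj (A : C) : E.Adj (T.μ.app A) (T.η.app (T.obj A)) :=
    OrderEnrichment.adj_unit_of_retraction hKZ (T.left_unit A)
  have l_hom : T.map l ≫ T.μ.app Y = T.μ.app (T.obj Y) ≫ l := by
    have h := (hl.map hT).comp (μ_adj Y)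
    rw [nη] at h
    exact h.left_unique ((μ_adj (T.obj Y)).comp hl)
  have l_ext : T.map (T.η.app (T.obj Y) ≫ l) ≫ T.μ.app Y = l := by
    rw [T.map_comp, Category.assoc, l_hom, ← Category.assoc, T.right_unit, Category.id_comp]
  have unit_l : E.le (T.η.app Y ≫ T.η.app (T.obj Y) ≫ l) (T.η.app Y) := by
    have h := E.comp_le_comp_left (T.η.app Y) hl.2
    rwa [← Category.assoc, nη, Category.assoc, Category.comp_id] at h
  obtain ⟨β, hβ⟩ := hY (T.obj Y) (T.η.app (T.obj Y) ≫ l) (T.η.app Y ≫ T.η.app (T.obj Y))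
    (by
      have h : T.map (T.η.app Y ≫ T.η.app (T.obj Y)) ≫ T.μ.app (T.obj Y) = T.map (T.η.app Y) := by
        simp
      rw [h]
      simpa using E.comp_le_comp_left (T.η.app (T.obj Y)) hl.1)
    (by rwa [l_ext, Category.assoc])
  have l_eq : l = T.map β := by
    rw [← l_ext, hβ]
    simp
  have id_le : E.le (𝟙 (T.obj Y)) (β ≫ T.η.app Y) := by
    apply hF
    simpa [l_eq] using hl.1
  have unit : T.η.app Y ≫ β = 𝟙 Y := by
    apply E.le_antisymm <;> apply OrderEnrichment.le_of_comp_unit_le hT hF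
    · simpa [hβ] using unit_l
    · simpa using E.comp_le_comp_left (T.η.app Y) id_le
  have β_adj := OrderEnrichment.adj_unit_of_retraction hKZ unit
  have h := (β_adj.map hT).comp β_adj
  rw [nη] at h
  exact ⟨β, unit, h.left_unique ((μ_adj Y).comp β_adj)⟩

end Monad

end OrderEnrichment

/-- For a Kock-Zöberlein monad `T` on an order-enriched category:
(a) every object carrying an Eilenberg–Moore `T`-algebra structure is Cauchy complete;
(b) if `T` is order-faithful, then `Y` carries an Eilenberg–Moore `T`-algebra structure iff
`Y` is Cauchy complete and `T e_Y` has a left adjoint in `C`. -/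
theorem stmt5 {C : Type u} [Category.{v} C] (E : OrderEnrichment C) (T : Monad C)
    (hT : ∀ {X Y : C} {f g : X ⟶ Y}, E.le f g → E.le (T.map f) (T.map g))
    (hKZ : ∀ X : C, E.le (T.map (T.η.app X)) (T.η.app (T.obj X))) :
    (∀ (Y : C) (β : T.obj Y ⟶ Y),
      (T.η.app Y ≫ β = 𝟙 Y ∧ T.map β ≫ β = T.μ.app Y ≫ β) → CauchyComplete E T Y) ∧
    ((∀ (X A : C) (f g : A ⟶ X), E.le (T.map f) (T.map g) → E.le f g) →
      ∀ Y : C,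
        (∃ β : T.obj Y ⟶ Y, T.η.app Y ≫ β = 𝟙 Y ∧ T.map β ≫ β = T.μ.app Y ≫ β) ↔
        (CauchyComplete E T Y ∧
          ∃ l : T.obj (T.obj Y) ⟶ T.obj Y,
            E.le (𝟙 (T.obj (T.obj Y))) (l ≫ T.map (T.η.app Y)) ∧
            E.le (T.map (T.η.app Y) ≫ l) (𝟙 (T.obj Y)))) := by
  refine ⟨fun Y β h => OrderEnrichment.cauchyComplete_of_algebra hT hKZ h.1 h.2, fun hF Y => ⟨?_, ?_⟩⟩
  · rintro ⟨β, hη, hμ⟩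
    exact ⟨OrderEnrichment.cauchyComplete_of_algebra hT hKZ hη hμ, T.map β,
      (OrderEnrichment.adj_unit_of_retraction hKZ hη).map hT⟩
  · rintro ⟨hY, l, hl⟩
    exact OrderEnrichment.exists_algebra_of_cauchyComplete hT hKZ hF hY hl
end

section
/- Let T = (T, m, e) be an idempotent monad on a category C (i.e., every component m_X : TTX → TX is an isomorphism) such that the functor T is faithful. Then an object Y of C carries an Eilenberg–Moore T-algebra structure (there exists β : TY → Y with β ∘ e_Y = id_Y and β ∘ T(β) = β ∘ m_Y) if and only if Y is Cauchy complete, meaning: for every object X and all morphisms r : X → TY and s : Y → TX with m_X ∘ T(s) ∘ r = e_X and m_Y ∘ T(r) ∘ s = e_Y (i.e., r is an isomorphism in the Kleisli category with inverse s), there exists f : X → Y in C with r = e_Y ∘ f. -/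
open CategoryTheory

universe v u

/-- For a monad with invertible multiplication, the two unit maps `T X ⟶ T (T X)` agree. -/
theorem CategoryTheory.Monad.map_unit_eq_unit_app {C : Type u} [Category.{v} C] (T : Monad C)
    (X : C) [IsIso (T.μ.app X)] : T.map (T.η.app X) = T.η.app (T.obj X) := by
  rw [← cancel_mono (T.μ.app X), T.right_unit, T.left_unit]
  rfl

/-- For an idempotent monad `T` (every `m_X` is an isomorphism) with `T`
faithful, an object `Y` carries an Eilenberg–Moore `T`-algebra structure iff `Y` is Cauchy
complete: every isomorphism `r : X ⇸ Y` in the Kleisli category (with inverse `s`) is of the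
form `e_Y ∘ f` for some `f : X ⟶ Y` in `C`. -/
theorem stmt6 {C : Type u} [Category.{v} C] (T : Monad C)
    (hidem : ∀ X : C, IsIso (T.μ.app X))
    (hfaith : ∀ {X Y : C} (f g : X ⟶ Y), T.map f = T.map g → f = g)
    (Y : C) :
    (∃ β : T.obj Y ⟶ Y, T.η.app Y ≫ β = 𝟙 Y ∧ T.map β ≫ β = T.μ.app Y ≫ β) ↔
    (∀ (X : C) (r : X ⟶ T.obj Y) (s : Y ⟶ T.obj X),
      r ≫ T.map s ≫ T.μ.app X = T.η.app X →
      s ≫ T.map r ≫ T.μ.app Y = T.η.app Y →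
      ∃ f : X ⟶ Y, r = f ≫ T.η.app Y) := by
  have map_unit (X : C) : T.map (T.η.app X) = T.η.app (T.obj X) :=
    have := hidem X
    T.map_unit_eq_unit_app X
  have unit_naturality {X Z : C} (f : X ⟶ Z) :
      f ≫ T.η.app Z = T.η.app X ≫ T.map f := T.η.naturality f
  constructor
  · rintro ⟨β, hβ, -⟩ X r - - -
    refine ⟨r ≫ β, ?_⟩
    rw [Category.assoc, unit_naturality β, ← map_unit, ← T.map_comp, hβ]
    simp
  · intro h
    obtain ⟨β, hβ⟩ := h (T.obj Y) (𝟙 _) (T.η.app Y ≫ T.η.app (T.obj Y))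
      (by simp [map_unit])
      (by simp)
    have map_β : T.map β = T.μ.app Y := by
      have : T.map β ≫ T.map (T.η.app Y) = 𝟙 _ := by rw [← T.map_comp, ← hβ, T.map_id]
      simpa using this =≫ T.μ.app Y
    refine ⟨β, hfaith _ _ ?_, by rw [map_β]⟩
    simp [map_β]
end

section
/- Let T = (T, m, e) be a Kock-Zöberlein monad on an order-enriched category C, let X be a T-algebra with structure map α : TX → X (so α ⊣ e_X), and let t : X → TX be any morphism of C. Then t is left adjoint to α (id_X ≤ α ∘ t and t ∘ α ≤ id_{TX}) if and only if t is a T-algebra homomorphism from (X, α) to (TX, m_X) with α ∘ t = id_X, i.e., m_X ∘ T(t) = t ∘ α and α ∘ t = id_X. -/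
open CategoryTheory

universe v u

section KockZoberlein

variable {C : Type u} [Category.{v} C] (E : OrderEnrichment C) (T : Monad C)

/-- For a Kock-Zöberlein monad, the unit of the adjunction `m_X ⊣ e_{TX}`. -/
lemma id_le_mul_comp_unit
    (hKZ : ∀ X : C, E.le (T.map (T.η.app X)) (T.η.app (T.obj X))) (X : C) :
    E.le (𝟙 (T.obj (T.obj X))) (T.μ.app X ≫ T.η.app (T.obj X)) := by
  have h := E.comp_le_comp_right (T.map (T.μ.app X)) (hKZ (T.obj X))
  have hn : T.μ.app X ≫ T.η.app (T.obj X) =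
      T.η.app (T.obj (T.obj X)) ≫ T.map (T.μ.app X) := T.η.naturality (T.μ.app X)
  rwa [← T.map_comp, T.left_unit, T.map_id, ← hn] at h

/-- If `α ∘ e_X ≤ id_X`, then `α ∘ T(α) ≤ α ∘ m_X`. -/
lemma map_comp_le_mul_comp
    (hKZ : ∀ X : C, E.le (T.map (T.η.app X)) (T.η.app (T.obj X)))
    {X : C} {α : T.obj X ⟶ X}
    (hcounit : E.le (T.η.app X ≫ α) (𝟙 X)) :
    E.le (T.map α ≫ α) (T.μ.app X ≫ α) := by
  have hn : α ≫ T.η.app X = T.η.app (T.obj X) ≫ T.map α := T.η.naturality α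
  have h₁ : E.le (T.map α ≫ α) (T.μ.app X ≫ α ≫ T.η.app X ≫ α) := by
    have h := E.comp_le_comp_right (T.map α ≫ α) (id_le_mul_comp_unit E T hKZ X)
    simpa only [Category.id_comp, Category.assoc, reassoc_of% hn] using h
  have h₂ := E.comp_le_comp_left (T.μ.app X ≫ α) hcounit
  simp only [Category.comp_id, Category.assoc] at h₂
  exact E.le_trans h₁ h₂

/-- If `t ⊣ α ⊣ e_X`, then `α ∘ t = id_X`. -/
lemma comp_eq_id_of_adjoint
    {X : C} {α : T.obj X ⟶ X} {t : X ⟶ T.obj X}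
    (hunit : E.le (𝟙 (T.obj X)) (α ≫ T.η.app X))
    (hcounit : E.le (T.η.app X ≫ α) (𝟙 X))
    (hunit' : E.le (𝟙 X) (t ≫ α)) (hcounit' : E.le (α ≫ t) (𝟙 (T.obj X))) :
    t ≫ α = 𝟙 X := by
  have hαe : α ≫ T.η.app X ≫ α = α := by
    apply E.le_antisymm
    · simpa using E.comp_le_comp_left α hcounit
    · simpa using E.comp_le_comp_right α hunit
  have heαe : T.η.app X ≫ α ≫ T.η.app X = T.η.app X := by
    apply E.le_antisymm
    · simpa using E.comp_le_comp_right (T.η.app X) hcounit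
    · simpa using E.comp_le_comp_left (T.η.app X) hunit
  have hαt : α ≫ t ≫ α = α := by
    apply E.le_antisymm
    · simpa using E.comp_le_comp_right α hcounit'
    · simpa using E.comp_le_comp_left α hunit'
  have hTe : T.map (T.η.app X ≫ α) = 𝟙 (T.obj X) := by
    have hr : T.map (T.η.app X) ≫ T.μ.app X = 𝟙 (T.obj X) := T.right_unit X
    have h := congrArg (fun f => T.map f ≫ T.μ.app X) heαe
    simp only [T.map_comp, Category.assoc, hr] at h
    rw [T.map_comp]
    exact (congrArg (T.map (T.η.app X) ≫ ·) (Category.comp_id (T.map α))).symm.trans h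
  have hTα : T.map (T.η.app X) ≫ T.map α = 𝟙 (T.obj X) := by rw [← T.map_comp, hTe]
  have hTt : T.map (t ≫ α) = 𝟙 (T.obj X) := by
    have h := congrArg (fun f => T.map (T.η.app X) ≫ T.map f) hαt
    simp only [T.map_comp, reassoc_of% hTα, hTα] at h
    exact (T.map_comp t α).trans h
  have hn : (t ≫ α) ≫ T.η.app X = T.η.app X ≫ T.map (t ≫ α) := T.η.naturality (t ≫ α)
  have heq : t ≫ α = T.η.app X ≫ α := by
    rw [hTt, Category.comp_id] at hn
    have h := congrArg (· ≫ α) hn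
    simpa only [Category.assoc, hαe] using h
  exact E.le_antisymm (heq ▸ hcounit) hunit'

end KockZoberlein

/-- For a Kock-Zöberlein monad `T`, a `T`-algebra `(X, α)` (so `α ⊣ e_X`) and
`t : X ⟶ TX`: `t ⊣ α` iff `t` is a `T`-algebra homomorphism `(X, α) → (TX, m_X)` with
`α ∘ t = id`. -/
theorem stmt7 {C : Type u} [Category.{v} C] (E : OrderEnrichment C) (T : Monad C)
    (hT : ∀ {X Y : C} {f g : X ⟶ Y}, E.le f g → E.le (T.map f) (T.map g))
    (hKZ : ∀ X : C, E.le (T.map (T.η.app X)) (T.η.app (T.obj X)))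
    (X : C) (α : T.obj X ⟶ X)
    (hα : E.le (𝟙 (T.obj X)) (α ≫ T.η.app X) ∧ E.le (T.η.app X ≫ α) (𝟙 X))
    (t : X ⟶ T.obj X) :
    (E.le (𝟙 X) (t ≫ α) ∧ E.le (α ≫ t) (𝟙 (T.obj X))) ↔
    (T.map t ≫ T.μ.app X = α ≫ t ∧ t ≫ α = 𝟙 X) := by
  obtain ⟨hunit, hcounit⟩ := hα
  have ht : T.η.app X ≫ T.map t = t ≫ T.η.app (T.obj X) := (T.η.naturality t).symm
  have hl : T.η.app (T.obj X) ≫ T.μ.app X = 𝟙 (T.obj X) := T.left_unit X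
  constructor
  · rintro ⟨hunit', hcounit'⟩
    have hid := comp_eq_id_of_adjoint E T hunit hcounit hunit' hcounit'
    refine ⟨E.le_antisymm ?_ ?_, hid⟩
    · have h := E.comp_le_comp_right (T.map t ≫ T.μ.app X) hunit
      simpa only [Category.id_comp, Category.assoc, reassoc_of% ht, hl, Category.comp_id] using h
    · have hTid : T.map t ≫ T.map α = 𝟙 _ := by rw [← T.map_comp, hid, T.map_id]
      have h₁ := E.comp_le_comp_left (T.map t)
        (E.comp_le_comp_right t (map_comp_le_mul_comp E T hKZ hcounit))
      have h₂ := E.comp_le_comp_left (T.map t ≫ T.μ.app X) hcounit'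
      simp only [Category.assoc, reassoc_of% hTid, Category.comp_id] at h₁ h₂
      exact E.le_trans h₁ h₂
  · rintro ⟨hhom, hid⟩
    refine ⟨hid ▸ E.le_refl _, ?_⟩
    have hle : E.le t (T.η.app X) := by
      simpa [reassoc_of% hid] using E.comp_le_comp_left t hunit
    have h := E.comp_le_comp_right (T.μ.app X) (hT hle)
    rwa [hhom, T.right_unit] at h
end

section
/- Let T = (T, m, e) be a Kock-Zöberlein monad on an order-enriched category C that has equalisers, such that T sends regular monomorphisms to monomorphisms. Let X be a split T-algebra with t ⊣ α ⊣ e_X and let i : A → X be an equaliser of the pair e_X, t : X → TX. Then (X, α) is algebraic — isomorphic in the Eilenberg–Moore category to a free algebra (TY, m_Y) for some object Y — if and only if T(i) : TA → TX is a left adjoint in C (there exists g : TX → TA with T(i) ⊣ g) and α ∘ T(i) : TA → X is an epimorphism in C. -/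
open CategoryTheory

universe v u

open CategoryTheory.Limits

/-- The algebra `(X, α)` is algebraic: isomorphic in the Eilenberg–Moore category to a free
algebra `(TY, m_Y)` for some object `Y`. -/
def IsAlgebraicAlgebra {C : Type u} [Category.{v} C] (T : Monad C)
    (X : C) (α : T.obj X ⟶ X) : Prop :=
  ∃ (Y : C) (f : T.obj Y ⟶ X) (g : X ⟶ T.obj Y),
    T.map f ≫ α = T.μ.app Y ≫ f ∧ f ≫ g = 𝟙 (T.obj Y) ∧ g ≫ f = 𝟙 X

namespace OrderEnrichment

variable {C : Type u} [Category.{v} C] (E : OrderEnrichment C)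

/-- Left adjoints of a given morphism are unique. -/
theorem leftAdjoint_unique {X Y : C} {r : Y ⟶ X} {l l' : X ⟶ Y}
    (unit : E.le (𝟙 X) (l ≫ r)) (counit : E.le (r ≫ l) (𝟙 Y))
    (unit' : E.le (𝟙 X) (l' ≫ r)) (counit' : E.le (r ≫ l') (𝟙 Y)) : l = l' := by
  have le_of_adj : ∀ {p q : X ⟶ Y}, E.le (𝟙 X) (q ≫ r) → E.le (r ≫ p) (𝟙 Y) → E.le p q := by
    intro p q hq hp
    have h₁ := E.comp_le_comp_right p hq
    have h₂ := E.comp_le_comp_left q hp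
    simp only [Category.assoc, Category.id_comp, Category.comp_id] at h₁ h₂
    exact E.le_trans h₁ h₂
  exact E.le_antisymm (le_of_adj unit' counit) (le_of_adj unit counit')

/-- If `T` is of Kock-Zöberlein type, then `T(e_Y) ∘ m_Y ≤ 1`. -/
theorem mu_comp_map_eta_le (T : Monad C)
    (hT : ∀ {X Y : C} {f g : X ⟶ Y}, E.le f g → E.le (T.map f) (T.map g))
    (hKZ : ∀ X : C, E.le (T.map (T.η.app X)) (T.η.app (T.obj X))) (Y : C) :
    E.le (T.μ.app Y ≫ T.map (T.η.app Y)) (𝟙 (T.obj (T.obj Y))) := by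
  have h := E.comp_le_comp_right (T.μ.app (T.obj Y)) (hT (hKZ Y))
  rw [T.right_unit] at h
  have hn := T.μ.naturality (T.η.app Y)
  dsimp at hn
  rwa [hn] at h

/-- The splitting of a split algebra is a homomorphism of algebras. -/
theorem splitting_hom (T : Monad C)
    (hT : ∀ {X Y : C} {f g : X ⟶ Y}, E.le f g → E.le (T.map f) (T.map g))
    {X : C} {α : T.obj X ⟶ X} {t : X ⟶ T.obj X}
    (assoc : T.map α ≫ α = T.μ.app X ≫ α)
    (unit : E.le (𝟙 (T.obj X)) (α ≫ T.η.app X))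
    (unit' : E.le (𝟙 X) (t ≫ α)) (counit' : E.le (α ≫ t) (𝟙 (T.obj X))) :
    α ≫ t = T.map t ≫ T.μ.app X := by
  apply E.le_antisymm
  · have h₁ := E.comp_le_comp_right (α ≫ t) (hT unit')
    have h₂ := E.comp_le_comp_left (T.map t ≫ T.μ.app X) counit'
    rw [T.map_id, Category.id_comp, T.map_comp, Category.assoc, ← Category.assoc (T.map α),
      assoc, Category.assoc] at h₁
    rw [Category.comp_id, Category.assoc] at h₂
    exact E.le_trans h₁ h₂
  · have h := E.comp_le_comp_right (T.map t ≫ T.μ.app X) unit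
    have hn : t ≫ T.η.app (T.obj X) = T.η.app X ≫ T.map t := T.η.naturality t
    have hu : T.η.app (T.obj X) ≫ T.μ.app X = 𝟙 (T.obj X) := T.left_unit X
    rwa [Category.id_comp, Category.assoc, ← Category.assoc (T.η.app X), ← hn, Category.assoc,
      hu, Category.comp_id] at h

end OrderEnrichment

/-- Let `T` be a Kock-Zöberlein monad on an order-enriched category with
equalisers such that `T` sends regular monos to monos, let `X` be a split `T`-algebra with
`t ⊣ α ⊣ e_X`, and let `i : A → X` be an equaliser of `e_X, t : X ⟶ TX`. Then `(X, α)` is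
algebraic iff `T i` is a left adjoint in `C` and `α ∘ T i : TA → X` is an epimorphism. -/
theorem stmt11 {C : Type u} [Category.{v} C] (E : OrderEnrichment C) (T : Monad C)
    (hT : ∀ {X Y : C} {f g : X ⟶ Y}, E.le f g → E.le (T.map f) (T.map g))
    (hKZ : ∀ X : C, E.le (T.map (T.η.app X)) (T.η.app (T.obj X)))
    [HasEqualizers C]
    (hreg : ∀ {X Y : C} (f : X ⟶ Y), RegularMono f → Mono (T.map f))
    (X : C) (α : T.obj X ⟶ X) (t : X ⟶ T.obj X)
    (halg : T.η.app X ≫ α = 𝟙 X ∧ T.map α ≫ α = T.μ.app X ≫ α)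
    (hαe : E.le (𝟙 (T.obj X)) (α ≫ T.η.app X) ∧ E.le (T.η.app X ≫ α) (𝟙 X))
    (htα : E.le (𝟙 X) (t ≫ α) ∧ E.le (α ≫ t) (𝟙 (T.obj X)))
    (A : C) (i : A ⟶ X)
    (hfork : i ≫ T.η.app X = i ≫ t)
    (huniv : ∀ {W : C} (h : W ⟶ X), h ≫ T.η.app X = h ≫ t → ∃! k : W ⟶ A, k ≫ i = h) :
    IsAlgebraicAlgebra T X α ↔
      ((∃ g : T.obj X ⟶ T.obj A,
          E.le (𝟙 (T.obj A)) (T.map i ≫ g) ∧ E.le (g ≫ T.map i) (𝟙 (T.obj X))) ∧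
        Epi (T.map i ≫ α)) := by
  have hsplit : (T.map i ≫ α) ≫ t = T.map i := by
    rw [Category.assoc, E.splitting_hom T hT halg.2 hαe.1 htα.1 htα.2, ← Category.assoc,
      ← T.map_comp, ← hfork, T.map_comp, Category.assoc, T.right_unit]
    exact Category.comp_id _
  have hmono_i : Mono (T.map i) :=
    hreg i
      { Z := T.obj X
        left := T.η.app X
        right := t
        w := hfork
        isLimit := Fork.IsLimit.ofExistsUnique fun s => huniv s.ι s.condition }
  have hmono : Mono (T.map i ≫ α) := by
    rw [← hsplit] at hmono_i
    exact mono_of_mono (T.map i ≫ α) t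
  constructor
  · rintro ⟨Y, f, g, hf, hfg, hgf⟩
    have hηf : T.map (T.η.app Y) ≫ T.map f ≫ α = f := by
      rw [hf, ← Category.assoc, T.right_unit]
      exact Category.id_comp f
    have hα : α = T.map g ≫ T.μ.app Y ≫ f := by
      rw [← hf, ← Category.assoc, ← T.map_comp, hgf, T.map_id, Category.id_comp]
    have ht : t = g ≫ T.map (T.η.app Y) ≫ T.map f := by
      refine E.leftAdjoint_unique htα.1 htα.2 ?_ ?_
      · have h : (g ≫ T.map (T.η.app Y) ≫ T.map f) ≫ α = 𝟙 X := by
          simp only [Category.assoc]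
          rw [hηf, hgf]
        rw [h]
        exact E.le_refl _
      · have h := E.comp_le_comp_left (T.map g)
          (E.comp_le_comp_right (T.map f) (E.mu_comp_map_eta_le T hT hKZ Y))
        rw [Category.id_comp, ← T.map_comp, hgf, T.map_id] at h
        rw [hα]
        simp only [Category.assoc] at h ⊢
        rwa [← Category.assoc f g, hfg, Category.id_comp]
    have hequal : (T.η.app Y ≫ f) ≫ T.η.app X = (T.η.app Y ≫ f) ≫ t := by
      have h₁ := T.η.naturality f
      have h₂ := T.η.naturality (T.η.app Y)
      dsimp at h₁ h₂
      rw [ht, Category.assoc, Category.assoc, ← Category.assoc f g, hfg, Category.id_comp, h₁,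
        ← Category.assoc, ← Category.assoc, h₂]
    obtain ⟨k, hk⟩ : ∃ k : Y ⟶ A, T.map k ≫ T.map i = T.map (T.η.app Y) ≫ T.map f := by
      obtain ⟨k, hk, -⟩ := huniv _ hequal
      exact ⟨k, by rw [← T.map_comp, ← T.map_comp]; exact congrArg T.map hk⟩
    have hsection : (g ≫ T.map k) ≫ T.map i ≫ α = 𝟙 X := by
      rw [Category.assoc, ← Category.assoc (T.map k), hk, Category.assoc, hηf]
      exact hgf
    have hretract : (T.map i ≫ α) ≫ g ≫ T.map k = 𝟙 (T.obj A) := by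
      rw [← cancel_mono (T.map i ≫ α), Category.assoc, hsection, Category.comp_id,
        Category.id_comp]
    refine ⟨⟨α ≫ g ≫ T.map k, ?_, ?_⟩, ⟨fun a b hab => ?_⟩⟩
    · rw [← Category.assoc, hretract]
      exact E.le_refl _
    · have h : (α ≫ g ≫ T.map k) ≫ T.map i = α ≫ t := by
        rw [← hsplit, Category.assoc, ← Category.assoc _ _ t, hsection, Category.id_comp]
      rw [h]
      exact htα.2
    · rw [← Category.id_comp a, ← Category.id_comp b, ← hsection, Category.assoc,
        Category.assoc _ _ b, hab]
  · rintro ⟨⟨g, hunit, hcounit⟩, hepi⟩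
    have hid : (T.map i ≫ α) ≫ (T.η.app X ≫ g) ≫ T.map i ≫ α = T.map i ≫ α := by
      apply E.le_antisymm
      · have h := E.comp_le_comp_left ((T.map i ≫ α) ≫ T.η.app X)
          (E.comp_le_comp_right α hcounit)
        simp only [Category.assoc, Category.id_comp, halg.1, Category.comp_id] at h ⊢
        exact h
      · have h₁ := E.comp_le_comp_right (T.map i ≫ α) hunit
        have h₂ := E.comp_le_comp_left (T.map i)
          (E.comp_le_comp_right (g ≫ T.map i ≫ α) hαe.1)
        simp only [Category.assoc, Category.id_comp] at h₁ h₂ ⊢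
        exact E.le_trans h₁ h₂
    refine ⟨A, T.map i ≫ α, T.η.app X ≫ g, ?_, ?_, ?_⟩
    · have hn := T.μ.naturality i
      dsimp at hn
      rw [T.map_comp, Category.assoc, halg.2, ← Category.assoc, hn, Category.assoc]
    · rw [← cancel_mono (T.map i ≫ α), Category.assoc, hid, Category.id_comp]
    · rw [← cancel_epi (T.map i ≫ α), hid, Category.comp_id]
end

section
/- Let X be a sober T0 topological space and let Λ be a family of open subsets of X containing X, closed under binary intersections, and forming a base of the topology. Let F ⊆ Λ be a filter of the poset (Λ, ⊆): F is nonempty, closed under binary intersections, and upward closed within Λ (if U ∈ F, V ∈ Λ and U ⊆ V then V ∈ F). Assume moreover that F has the property: for every family (V_i)_{i ∈ I} of members of Λ, if the union ⋃_{i∈I} V_i belongs to Λ and to F, then V_j ∈ F for some j ∈ I. Then there exists a unique x ∈ X such that F = {U ∈ Λ | x ∈ U}. -/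
/-- Let `X` be a sober T0 space and `Λ` a family of open sets containing `X`,
closed under binary intersections and forming a base of the topology. Every filter `F` of the
poset `(Λ, ⊆)` such that, whenever a union of members of `Λ` belongs to `Λ` and to `F`, some
member of the family belongs to `F`, is the trace on `Λ` of the open-neighbourhood filter of
a unique point. -/
theorem stmt12 {X : Type*} [TopologicalSpace X] [T0Space X] [QuasiSober X]
    (Λ : Set (Set X))
    (hopen : ∀ U ∈ Λ, IsOpen U)
    (htop : Set.univ ∈ Λ)
    (hinter : ∀ U ∈ Λ, ∀ V ∈ Λ, U ∩ V ∈ Λ)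
    (hbase : ∀ U : Set X, IsOpen U → ∀ x ∈ U, ∃ V ∈ Λ, x ∈ V ∧ V ⊆ U)
    (F : Set (Set X))
    (hFΛ : F ⊆ Λ)
    (hFne : F.Nonempty)
    (hFinter : ∀ U ∈ F, ∀ V ∈ F, U ∩ V ∈ F)
    (hFup : ∀ U ∈ F, ∀ V ∈ Λ, U ⊆ V → V ∈ F)
    (hFprime : ∀ S : Set (Set X), (∀ V ∈ S, V ∈ Λ) → ⋃₀ S ∈ Λ → ⋃₀ S ∈ F →
      ∃ V ∈ S, V ∈ F) :
    ∃! x : X, F = {U | U ∈ Λ ∧ x ∈ U} := by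
  let Z : Set X := (⋃₀ {V | V ∈ Λ ∧ V ∉ F})ᶜ
  have hZclosed : IsClosed Z :=
    (isOpen_sUnion fun V hV => hopen V hV.1).isClosed_compl
  have mem_of_meets {U : Set X} (hU : U ∈ Λ) {z : X} (hz : z ∈ Z) (hzU : z ∈ U) : U ∈ F := by
    by_contra hUF
    exact hz ⟨U, ⟨hU, hUF⟩, hzU⟩
  have meets_of_mem {U : Set X} (hU : U ∈ F) : (Z ∩ U).Nonempty := by
    by_contra hempty
    have hcover : ⋃₀ {W | W ∈ Λ ∧ W ⊆ U ∧ W ∉ F} = U := by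
      refine Set.Subset.antisymm (Set.sUnion_subset fun W hW => hW.2.1) fun x hx => ?_
      have hxZ : x ∉ Z := fun h => hempty ⟨x, h, hx⟩
      obtain ⟨V, ⟨hV, hVF⟩, hxV⟩ := Set.notMem_compl_iff.mp hxZ
      exact ⟨V ∩ U, ⟨hinter V hV U (hFΛ hU), Set.inter_subset_right,
        fun h => hVF (hFup _ h V hV Set.inter_subset_left)⟩, hxV, hx⟩
    obtain ⟨W, hW, hWF⟩ := hFprime _ (fun W hW => hW.1)
      (hcover.symm ▸ hFΛ hU) (hcover.symm ▸ hU)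
    exact hW.2.2 hWF
  have hZirred : IsIrreducible Z := by
    refine ⟨?_, ?_⟩
    · obtain ⟨U, hU⟩ := hFne
      exact (meets_of_mem hU).mono Set.inter_subset_left
    · rintro u v hu hv ⟨y, hyZ, hyu⟩ ⟨z, hzZ, hzv⟩
      obtain ⟨V, hV, hyV, hVu⟩ := hbase u hu y hyu
      obtain ⟨W, hW, hzW, hWv⟩ := hbase v hv z hzv
      exact (meets_of_mem (hFinter V (mem_of_meets hV hyZ hyV) W
        (mem_of_meets hW hzZ hzW))).mono
        (Set.inter_subset_inter_right Z (Set.inter_subset_inter hVu hWv))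
  obtain ⟨x, hx⟩ := QuasiSober.sober hZirred hZclosed
  have hFx : F = {U | U ∈ Λ ∧ x ∈ U} := Set.ext fun U =>
    ⟨fun hU => ⟨hFΛ hU, (hx.mem_open_set_iff (hopen U (hFΛ hU))).mpr (meets_of_mem hU)⟩,
      fun hU => mem_of_meets hU.1 hx.mem hU.2⟩
  refine ⟨x, hFx, fun y hFy => ?_⟩
  have mem_iff (U : Set X) (hU : U ∈ Λ) : y ∈ U ↔ x ∈ U := by
    have h : U ∈ {U | U ∈ Λ ∧ y ∈ U} ↔ U ∈ {U | U ∈ Λ ∧ x ∈ U} := by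
      rw [← hFy, ← hFx]
    simpa [hU] using h
  refine (inseparable_iff_forall_isOpen.mpr fun u hu => ⟨fun hy => ?_, fun hx => ?_⟩).eq
  · obtain ⟨V, hV, hyV, hVu⟩ := hbase u hu y hy
    exact hVu ((mem_iff V hV).mp hyV)
  · obtain ⟨V, hV, hxV, hVu⟩ := hbase u hu x hx
    exact hVu ((mem_iff V hV).mpr hxV)
end

section
/- Let X and Y be directed-complete partial orders, let α : Y → X and t : X → Y be monotone maps with α left adjoint to t (α(y) ≤ x ⟺ y ≤ t(x) for all x, y), let α be surjective, and let t preserve directed suprema. Then: (1) α preserves the way-below relation: y₀ ≪ y₁ in Y implies α(y₀) ≪ α(y₁) in X; (2) if Y is continuous (for every y ∈ Y the set {z | z ≪ y} is directed with supremum y), then X is continuous; (3) if moreover Y is algebraic (for every y ∈ Y the set of compact elements below y is directed with supremum y), then the compact elements of X are exactly the images under α of the compact elements of Y. -/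
/-- The way-below relation on a partial order with suprema: `x` is way below `y` if every
(nonempty) directed set whose supremum dominates `y` contains an element above `x`. -/
def WayBelow {α : Type*} [PartialOrder α] [SupSet α] (x y : α) : Prop :=
  ∀ D : Set α, D.Nonempty → DirectedOn (· ≤ ·) D → y ≤ sSup D → ∃ d ∈ D, x ≤ d

theorem WayBelow.le {X : Type*} [PartialOrder X] [SupSet X]
    (hXdc : ∀ D : Set X, D.Nonempty → DirectedOn (· ≤ ·) D → IsLUB D (sSup D))
    {x y : X} (h : WayBelow x y) : x ≤ y := by
  have hy : DirectedOn (· ≤ ·) ({y} : Set X) := directedOn_singleton y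
  have hsup := hXdc {y} (Set.singleton_nonempty y) hy
  obtain ⟨d, rfl, hd⟩ := h {y} (Set.singleton_nonempty y) hy (hsup.1 rfl)
  exact hd

/-- A directed set of elements way below `x` with supremum `x` is cofinal among all elements
way below `x`, so these too form a directed set with supremum `x`. -/
theorem directedOn_setOf_wayBelow {X : Type*} [PartialOrder X] [SupSet X]
    (hXdc : ∀ D : Set X, D.Nonempty → DirectedOn (· ≤ ·) D → IsLUB D (sSup D))
    {x : X} {B : Set X} (hne : B.Nonempty) (hdir : DirectedOn (· ≤ ·) B)
    (hB : ∀ b ∈ B, WayBelow b x) (hlub : IsLUB B x) :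
    {z : X | WayBelow z x}.Nonempty ∧ DirectedOn (· ≤ ·) {z : X | WayBelow z x} ∧
      sSup {z : X | WayBelow z x} = x := by
  have hsup : sSup B = x := (hXdc B hne hdir).unique hlub
  have hne' : {z : X | WayBelow z x}.Nonempty := hne.mono hB
  have hdir' : DirectedOn (· ≤ ·) {z : X | WayBelow z x} := by
    intro a ha b hb
    obtain ⟨c, hc, hac⟩ := ha B hne hdir hsup.ge
    obtain ⟨d, hd, hbd⟩ := hb B hne hdir hsup.ge
    obtain ⟨e, he, hce, hde⟩ := hdir c hc d hd
    exact ⟨e, hB e he, hac.trans hce, hbd.trans hde⟩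
  refine ⟨hne', hdir', (hXdc _ hne' hdir').unique ⟨fun z hz => ?_, fun u hu => ?_⟩⟩
  · exact WayBelow.le hXdc hz
  · exact hlub.2 fun b hb => hu (hB b hb)

/-- Let `X`, `Y` be dcpos, `α : Y → X` and `t : X → Y` monotone with `α ⊣ t`,
`α` surjective and `t` preserving directed suprema. Then (1) `α` preserves the way-below
relation; (2) if `Y` is continuous then so is `X`; (3) if moreover `Y` is algebraic, the
compact elements of `X` are exactly the `α`-images of the compact elements of `Y`. -/
theorem stmt15 {X Y : Type*} [PartialOrder X] [SupSet X] [PartialOrder Y] [SupSet Y]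
    (hXdc : ∀ D : Set X, D.Nonempty → DirectedOn (· ≤ ·) D → IsLUB D (sSup D))
    (hYdc : ∀ D : Set Y, D.Nonempty → DirectedOn (· ≤ ·) D → IsLUB D (sSup D))
    (α : Y → X) (t : X → Y) (hαmono : Monotone α) (htmono : Monotone t)
    (hadj : ∀ (x : X) (y : Y), α y ≤ x ↔ y ≤ t x)
    (hsurj : Function.Surjective α)
    (ht : ∀ D : Set X, D.Nonempty → DirectedOn (· ≤ ·) D → t (sSup D) = sSup (t '' D)) :
    (∀ y₀ y₁ : Y, WayBelow y₀ y₁ → WayBelow (α y₀) (α y₁)) ∧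
    ((∀ y : Y, {z : Y | WayBelow z y}.Nonempty ∧ DirectedOn (· ≤ ·) {z : Y | WayBelow z y} ∧
        sSup {z : Y | WayBelow z y} = y) →
      ∀ x : X, {z : X | WayBelow z x}.Nonempty ∧ DirectedOn (· ≤ ·) {z : X | WayBelow z x} ∧
        sSup {z : X | WayBelow z x} = x) ∧
    ((∀ y : Y, {z : Y | WayBelow z z ∧ z ≤ y}.Nonempty ∧
        DirectedOn (· ≤ ·) {z : Y | WayBelow z z ∧ z ≤ y} ∧
        sSup {z : Y | WayBelow z z ∧ z ≤ y} = y) →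
      {x : X | WayBelow x x} = α '' {y : Y | WayBelow y y}) := by
  have hgc : GaloisConnection α t := fun y x => hadj x y
  have hαt : ∀ x, α (t x) = x := fun x => by
    obtain ⟨y, rfl⟩ := hsurj x
    exact hgc.l_u_l_eq_l y
  have hdirα : ∀ D : Set Y, DirectedOn (· ≤ ·) D → DirectedOn (· ≤ ·) (α '' D) :=
    fun D hD => directedOn_image.2 (hD.mono fun _ _ h => hαmono h)
  have hdirt : ∀ D : Set X, DirectedOn (· ≤ ·) D → DirectedOn (· ≤ ·) (t '' D) :=
    fun D hD => directedOn_image.2 (hD.mono fun _ _ h => htmono h)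
  have hlub : ∀ (x : X) (D : Set Y), D.Nonempty → DirectedOn (· ≤ ·) D → sSup D = t x →
      IsLUB (α '' D) x := by
    intro x D hne hdir hD
    have h := hgc.isLUB_l_image (hYdc D hne hdir)
    rwa [hD, hαt] at h
  have hway : ∀ y₀ y₁ : Y, WayBelow y₀ y₁ → WayBelow (α y₀) (α y₁) := by
    intro y₀ y₁ h D hne hdir hle
    obtain ⟨_, ⟨d, hd, rfl⟩, hyd⟩ := h (t '' D) (hne.image t) (hdirt D hdir)
      (ht D hne hdir ▸ (hadj _ _).1 hle)
    exact ⟨d, hd, (hadj _ _).2 hyd⟩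
  refine ⟨hway, fun hcont x => ?_, fun halg => Set.Subset.antisymm (fun x hx => ?_) ?_⟩
  · obtain ⟨hne, hdir, hsup⟩ := hcont (t x)
    refine directedOn_setOf_wayBelow hXdc (hne.image α) (hdirα _ hdir) ?_
      (hlub x _ hne hdir hsup)
    rintro _ ⟨z, hz, rfl⟩
    simpa only [hαt] using hway z (t x) hz
  · obtain ⟨hne, hdir, hsup⟩ := halg (t x)
    have hx_lub := hlub x _ hne hdir hsup
    obtain ⟨_, ⟨k, ⟨hk, hkx⟩, rfl⟩, hxk⟩ := hx _ (hne.image α) (hdirα _ hdir)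
      ((hXdc _ (hne.image α) (hdirα _ hdir)).unique hx_lub).ge
    exact ⟨k, hk, le_antisymm ((hadj _ _).2 hkx) hxk⟩
  · rintro _ ⟨y, hy, rfl⟩
    exact hway y y hy
end
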